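/- Let (P_i)_{i∈I} be a strongly summable family of strong operators on C[[𝔐]] and let Q be a strong operator on C[[𝔐]]. Then the families (P_i Q)_{i∈I} and (Q P_i)_{i∈I} are strongly summable, with ∑_i (P_i Q) = (∑_i P_i) Q and ∑_i (Q P_i) = Q (∑_i P_i). -/

import Mathlib

/-!
The Hahn space `C[[𝔐]]` is modeled, as in the paper (via an order-reversing
isomorphism `𝔐 ≅ t^Γ`), by Mathlib's `HahnSeries Γ C`, whose elements have
(partially) well-ordered support.
-/

universe u v w

/-- A family of Hahn series is summable if the union of the supports is
(partially) well-ordered and, for each exponent, only finitely many members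
of the family have a nonzero coefficient there. -/
def IsSummableFam {Γ : Type u} [LinearOrder Γ] {C : Type v} [AddCommGroup C]
    {ι : Type w} (f : ι → HahnSeries Γ C) : Prop :=
  (⋃ i, (f i).support).IsPWO ∧ ∀ γ : Γ, {i | (f i).coeff γ ≠ 0}.Finite

open scoped Classical in
/-- The coefficient-wise sum of a summable family (junk value `0` otherwise). -/
noncomputable def famSum {Γ : Type u} [LinearOrder Γ] {C : Type v} [AddCommGroup C]
    {ι : Type w} (f : ι → HahnSeries Γ C) : HahnSeries Γ C :=
  if h : IsSummableFam f then
    (⟨f, h.1, h.2⟩ : HahnSeries.SummableFamily Γ C ι).hsum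
  else 0

/-- An operator on the Hahn space is additive if it preserves addition. -/
def IsAdditiveOp {Γ : Type u} [LinearOrder Γ] {C : Type v} [AddCommGroup C]
    (P : HahnSeries Γ C → HahnSeries Γ C) : Prop :=
  ∀ f g, P (f + g) = P f + P g

/-- An operator is strong (strongly additive) if it is additive, maps summable
families to summable families, and commutes with their sums. -/
def IsStrongOp {Γ : Type u} [LinearOrder Γ] {C : Type v} [AddCommGroup C]
    (P : HahnSeries Γ C → HahnSeries Γ C) : Prop :=
  IsAdditiveOp P ∧
    ∀ (ι : Type w) (f : ι → HahnSeries Γ C), IsSummableFam f →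
      IsSummableFam (fun i => P (f i)) ∧ famSum (fun i => P (f i)) = P (famSum f)

/-- A family of operators is summable if its family of values at every series
is summable. -/
def OpSummable {Γ : Type u} [LinearOrder Γ] {C : Type v} [AddCommGroup C]
    {ι : Type w} (P : ι → HahnSeries Γ C → HahnSeries Γ C) : Prop :=
  ∀ f, IsSummableFam fun i => P i f

/-- The sum of a family of operators, `(∑ᵢ Pᵢ) f = ∑ᵢ (Pᵢ f)`. -/
noncomputable def opSum {Γ : Type u} [LinearOrder Γ] {C : Type v} [AddCommGroup C]
    {ι : Type w} (P : ι → HahnSeries Γ C → HahnSeries Γ C) :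
    HahnSeries Γ C → HahnSeries Γ C :=
  fun f => famSum fun i => P i f

/-- A family of operators is strongly summable if it is summable and its sum
is a strong operator. -/
def OpStronglySummable {Γ : Type u} [LinearOrder Γ] {C : Type v} [AddCommGroup C]
    {ι : Type w} (P : ι → HahnSeries Γ C → HahnSeries Γ C) : Prop :=
  OpSummable P ∧ IsStrongOp.{u, v, w} (opSum P)

/-- The composition of two strong operators is strong. -/
theorem IsStrongOp.comp {Γ : Type u} [LinearOrder Γ] {C : Type v} [AddCommGroup C]
    {P Q : HahnSeries Γ C → HahnSeries Γ C}
    (hP : IsStrongOp.{u, v, w} P) (hQ : IsStrongOp.{u, v, w} Q) :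
    IsStrongOp.{u, v, w} (P ∘ Q) := by
  refine ⟨fun f g => ?_, fun κ f hf => ?_⟩
  · exact (congrArg P (hQ.1 f g)).trans (hP.1 _ _)
  · obtain ⟨hQf, hQ_sum⟩ := hQ.2 κ f hf
    obtain ⟨hPQf, hP_sum⟩ := hP.2 κ _ hQf
    exact ⟨hPQf, hP_sum.trans (congrArg P hQ_sum)⟩

/-- if `(Pᵢ)` is a strongly summable family of strong operators and
`Q` is a strong operator, then `(Pᵢ ∘ Q)` and `(Q ∘ Pᵢ)` are strongly summable,
with `∑ᵢ (Pᵢ Q) = (∑ᵢ Pᵢ) Q` and `∑ᵢ (Q Pᵢ) = Q (∑ᵢ Pᵢ)`. -/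
theorem opStronglySummable_comp {Γ : Type u} [LinearOrder Γ] {C : Type v} [AddCommGroup C]
    {ι : Type w}
    (P : ι → HahnSeries Γ C → HahnSeries Γ C)
    (Q : HahnSeries Γ C → HahnSeries Γ C)
    (hP : ∀ i, IsStrongOp.{u, v, w} (P i))
    (hPs : OpStronglySummable.{u, v, w} P)
    (hQ : IsStrongOp.{u, v, w} Q) :
    OpStronglySummable.{u, v, w} (fun i => P i ∘ Q) ∧
    OpStronglySummable.{u, v, w} (fun i => Q ∘ P i) ∧
    opSum (fun i => P i ∘ Q) = opSum P ∘ Q ∧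
    opSum (fun i => Q ∘ P i) = Q ∘ opSum P := by
  have h_left : opSum (fun i => Q ∘ P i) = Q ∘ opSum P :=
    funext fun f => (hQ.2 ι _ (hPs.1 f)).2
  refine ⟨⟨fun f => hPs.1 (Q f), hPs.2.comp hQ⟩,
    ⟨fun f => (hQ.2 ι _ (hPs.1 f)).1, ?_⟩, rfl, h_left⟩
  rw [h_left]
  exact hQ.comp hPs.2
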